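/- arXiv:2312.14514 — 2 statements merged into one kernel-verified Lean document; each statement's English description precedes it below -/
import Mathlib

section
/- Let A and B be alphabets with |A| ≥ 2 and let f be a uniform morphism from A* to B*. If there exist five letters a, b, c, d, x in A (possibly equal) and four words p, s, π, σ over B such that s is a suffix of f(a), p is a prefix of f(b), σ is a non-empty suffix of f(c), π is a non-empty prefix of f(d), and s·p = σ·f(x)·π, then f is not a square-free morphism. -/
/-- A word `u` contains a square `xx` (x nonempty) iff it is not square-free. -/
def SquareFree {B : Type*} (w : List B) : Prop :=
  ∀ u : List B, u ≠ [] → ¬ (u ++ u) <:+: w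

/-- `w` is a (k,n)-anti-power sequence: a concatenation of `k` pairwise
distinct words, each of length `n`. -/
def AntiPowerSeq {B : Type*} (k n : ℕ) (w : List B) : Prop :=
  ∃ l : List (List B), l.length = k ∧ (∀ u ∈ l, u.length = n) ∧
    l.Pairwise (· ≠ ·) ∧ w = l.flatten

/-- `AntiPowerWord k w`: a 2-anti-power word is a square-free word; for `k ≥ 3`,
a `k`-anti-power word is a `(k-1)`-anti-power word each of whose factors of
length `k·ℓ` (for `1 ≤ ℓ ≤ ⌊|w|/k⌋`) is a `(k,ℓ)`-anti-power sequence. -/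
def AntiPowerWord {B : Type*} : ℕ → List B → Prop
  | 0, _ => True
  | 1, _ => True
  | 2, w => SquareFree w
  | k + 3, w => AntiPowerWord (k + 2) w ∧
      ∀ ℓ : ℕ, 1 ≤ ℓ → ℓ ≤ w.length / (k + 3) →
        ∀ u : List B, u <:+: w → u.length = (k + 3) * ℓ → AntiPowerSeq (k + 3) ℓ u

/-- The action on words of the morphism `f : A* → B*` determined by its
values on letters. -/
def Morph.apply {A B : Type*} (f : A → List B) (w : List A) : List B :=
  (w.map f).flatten

theorem not_squareFree_append_of_comm {B : Type*} {u v : List B} (hu : u ≠ []) (hv : v ≠ [])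
    (h : u ++ v = v ++ u) : ¬ SquareFree (u ++ v) := by
  intro hsf
  rcases List.append_eq_append_iff.mp h with ⟨w, hw, -⟩ | ⟨w, hw, -⟩
  · exact hsf u hu ⟨[], w, by simp [hw]⟩
  · exact hsf v hv ⟨[], w, by rw [h, hw]; simp⟩

theorem not_squareFree_append_of_suffix_prefix {B : Type*} {u v w : List B} (hu : u ≠ [])
    (hv : u <:+ v) (hw : u <+: w) : ¬ SquareFree (v ++ w) := by
  obtain ⟨v', rfl⟩ := hv
  obtain ⟨w', rfl⟩ := hw
  exact fun hsf => hsf u hu ⟨v', w', by simp⟩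

theorem squareFree_singleton {A : Type*} (a : A) : SquareFree [a] := by
  intro u hu h
  have h1 := h.length_le
  have h2 := List.length_pos_iff.mpr hu
  simp at h1
  omega

theorem squareFree_pair {A : Type*} {a b : A} (hab : a ≠ b) : SquareFree [a, b] := by
  intro u hu h
  have h1 := h.length_le
  have h2 := List.length_pos_iff.mpr hu
  simp at h1
  obtain ⟨y, rfl⟩ := List.length_eq_one_iff.mp (show u.length = 1 by omega)
  have h3 := h.eq_of_length (by simp)
  simp at h3
  exact hab (h3.1.symm.trans h3.2)

/-- Let `|A| >= 2` and `f` a uniform morphism from `A*` to `B*`.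
If there exist letters `a, b, c, d, x` and words `p, s, π, σ` such that `s` is a
suffix of `f a`, `p` a prefix of `f b`, `σ` a non-empty suffix of `f c`, `π` a
non-empty prefix of `f d`, and `s ++ p = σ ++ f x ++ π`, then `f` is not a
square-free morphism. -/
theorem uniform_overlap_not_squareFree_morphism
    {A B : Type*} [Fintype A] (hA : 2 ≤ Fintype.card A)
    (f : A → List B) (L : ℕ) (hL : 1 ≤ L) (huni : ∀ a : A, (f a).length = L)
    (a b c d x : A) (p s π σ : List B)
    (hs : s <:+ f a) (hp : p <+: f b)
    (hσ : σ <:+ f c) (hσne : σ ≠ [])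
    (hπ : π <+: f d) (hπne : π ≠ [])
    (heq : s ++ p = σ ++ f x ++ π) :
    ¬ (∀ w : List A, SquareFree w → SquareFree (Morph.apply f w)) := by
  intro H
  have single : SquareFree (f x) := by
    simpa [Morph.apply] using H [x] (squareFree_singleton x)
  have pair : ∀ y z, y ≠ z → SquareFree (f y ++ f z) := fun y z hyz => by
    simpa [Morph.apply] using H [y, z] (squareFree_pair hyz)
  have hlen := congrArg List.length heq
  have hsl := hs.length_le
  have hpl := hp.length_le
  have hσ0 := List.length_pos_iff.mpr hσne
  have hπ0 := List.length_pos_iff.mpr hπne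
  simp only [List.length_append, huni] at hlen hsl hpl
  obtain ⟨s', rfl⟩ : σ <+: s :=
    List.prefix_of_prefix_length_le (l₃ := s ++ p) ⟨f x ++ π, by simp [heq]⟩
      (List.prefix_append s p) (by omega)
  obtain ⟨p', rfl⟩ : π <:+ p :=
    List.suffix_of_suffix_length_le (l₃ := σ ++ s' ++ p) ⟨σ ++ f x, by simp [heq]⟩
      (List.suffix_append _ p) (by omega)
  have hx : f x = s' ++ p' := by
    have h : σ ++ ((s' ++ p') ++ π) = σ ++ (f x ++ π) := by simpa using heq
    exact (List.append_cancel_right (List.append_cancel_left h)).symm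
  simp only [List.length_append] at hlen hsl hpl
  have hs' : s' ≠ [] := List.length_pos_iff.mp (by omega)
  have hp' : p' ≠ [] := List.length_pos_iff.mp (by omega)
  have hsa : s' <:+ f a := (List.suffix_append σ s').trans hs
  have hpb : p' <+: f b := (List.prefix_append p' π).trans hp
  have hax : a = x := by
    by_contra hne
    exact not_squareFree_append_of_suffix_prefix hs' hsa
      (hx ▸ List.prefix_append s' p') (pair a x hne)
  have hbx : b = x := by
    by_contra hne
    exact not_squareFree_append_of_suffix_prefix hp'
      (hx ▸ List.suffix_append s' p') hpb (pair x b (Ne.symm hne))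
  subst hax hbx
  obtain ⟨t, ht⟩ := hpb
  have hts : s' = t := by
    have hxl := congrArg List.length hx
    have htl := congrArg List.length ht
    simp only [List.length_append] at hxl htl
    exact (List.suffix_of_suffix_length_le hsa ⟨p', ht⟩ (by omega)).eq_of_length (by omega)
  refine not_squareFree_append_of_comm hs' hp' ?_ (hx ▸ single)
  rw [← hx, ← ht, hts]
end

section
/- The word abcab over the alphabet {a, b, c} is a 3-anti-power word but is not (3/2)-power-free (it contains the (5/3)-power abcab itself); hence the converse of the implication '(3/2)-power-free implies 3-anti-power' does not hold. -/
/-- `w` is `r`-power-free: it contains no factor of the form `(xy)^α ++ x` with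
`xy` non-empty whose exponent `α + |x|/|xy|` is at least `r`. -/
def FracPowerFree {B : Type*} (r : ℚ) (w : List B) : Prop :=
  ∀ (x y : List B) (α : ℕ), x ++ y ≠ [] →
    ((List.replicate α (x ++ y)).flatten ++ x) <:+: w →
    (α : ℚ) + (x.length : ℚ) / ((x ++ y).length : ℚ) < r

/-- The word `abcab` with distinct letters `a`, `b`, `c` is square-free. -/
theorem squareFree_abcab {A : Type*} {a b c : A} (hab : a ≠ b) (hac : a ≠ c) (hbc : b ≠ c) :
    SquareFree [a, b, c, a, b] := by
  rintro u hu ⟨s, t, h⟩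
  have hlen := congrArg List.length h
  simp only [List.length_append, List.length_cons, List.length_nil] at hlen
  rcases s with _ | ⟨s₁, _ | ⟨s₂, _ | ⟨s₃, _ | ⟨s₄, s⟩⟩⟩⟩ <;>
    rcases u with _ | ⟨u₁, _ | ⟨u₂, _ | ⟨u₃, u⟩⟩⟩ <;>
    simp only [List.length_cons, List.length_nil] at hlen <;>
    first | omega | grind

/-- Every factor of length three of `abcab` is a `(3, 1)`-anti-power sequence. -/
theorem antiPowerSeq_of_infix_abcab {A : Type*} {a b c : A}
    (hab : a ≠ b) (hac : a ≠ c) (hbc : b ≠ c) {u : List A}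
    (hu : u <:+: [a, b, c, a, b]) (hlen : u.length = 3) : AntiPowerSeq 3 1 u := by
  obtain ⟨s, t, h⟩ := hu
  obtain ⟨x, y, z, rfl⟩ := List.length_eq_three.mp hlen
  have hxyz : x ≠ y ∧ x ≠ z ∧ y ≠ z := by
    have hlen' := congrArg List.length h
    simp only [List.length_append, List.length_cons, List.length_nil] at hlen'
    rcases s with _ | ⟨s₁, _ | ⟨s₂, _ | ⟨s₃, s⟩⟩⟩ <;>
      simp only [List.length_cons, List.length_nil] at hlen' <;>
      first | omega | grind
  exact ⟨[[x], [y], [z]], rfl, by simp, by simpa [and_assoc] using hxyz, rfl⟩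

/-- The word `abcab` over the alphabet `{a, b, c}` is a
3-anti-power word but is not (3/2)-power-free; hence (3/2)-power-freeness is not
implied by being a 3-anti-power word. -/
theorem abcab_antiPower_not_fracPowerFree
    {A : Type*} (a b c : A) (hab : a ≠ b) (hac : a ≠ c) (hbc : b ≠ c) :
    AntiPowerWord 3 [a, b, c, a, b] ∧
      ¬ FracPowerFree (3/2 : ℚ) [a, b, c, a, b] := by
  refine ⟨⟨squareFree_abcab hab hac hbc, fun ℓ hℓ hℓ' u hu hlen => ?_⟩, fun h => ?_⟩
  · obtain rfl : ℓ = 1 := by simp at hℓ'; omega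
    exact antiPowerSeq_of_infix_abcab hab hac hbc hu hlen
  · have := h [a, b] [c] 1 (by simp) (by simp)
    norm_num at this
end
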